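/- Let M ⊃ S ⊕ N be as above with S, N primitive in M and N = S^⊥. If M is p-unimodular for a prime p, then the anti-isometry κ restricts to an anti-isometry of the p-primary parts (discr S)_p → (discr N)_p; in particular ℓ_p(discr S) = ℓ_p(discr N). -/

import Mathlib

open LinearMap

variable {n : ℕ}

/-- A rational number is an integer. -/
def IsIntQ (q : ℚ) : Prop := ∃ m : ℤ, q = (m : ℚ)

/-- Integrality of a bilinear form on a `ℤ`-submodule: the lattice condition. -/
def IsIntegralLat (B : LinearMap.BilinForm ℚ (Fin n → ℚ)) (S : Submodule ℤ (Fin n → ℚ)) :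
    Prop := ∀ x ∈ S, ∀ y ∈ S, IsIntQ (B x y)

/-- The dual lattice `S* = {x ∈ V : B(x,S) ⊆ ℤ}` of a `ℤ`-submodule `S` of `V = ℚⁿ`. -/
def dualLat (B : LinearMap.BilinForm ℚ (Fin n → ℚ)) (S : Submodule ℤ (Fin n → ℚ)) :
    Submodule ℤ (Fin n → ℚ) where
  carrier := {x | ∀ s ∈ S, IsIntQ (B x s)}
  zero_mem' := fun s _ => ⟨0, by simp⟩
  add_mem' := by
    rintro x y hx hy s hs
    obtain ⟨a, ha⟩ := hx s hs
    obtain ⟨b, hb⟩ := hy s hs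
    exact ⟨a + b, by simp [map_add, ha, hb]⟩
  smul_mem' := by
    rintro c x hx s hs
    obtain ⟨a, ha⟩ := hx s hs
    refine ⟨c * a, ?_⟩
    have : B (c • x) s = c • (B x s) := by
      rw [map_zsmul]
      rfl
    rw [this, ha, zsmul_eq_mul]
    push_cast
    ring
  
/-- The orthogonal complement (in `V`) of a `ℤ`-submodule. -/
def orthLat (B : LinearMap.BilinForm ℚ (Fin n → ℚ)) (S : Submodule ℤ (Fin n → ℚ)) :
    Submodule ℤ (Fin n → ℚ) where
  carrier := {x | ∀ s ∈ S, B x s = 0}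
  zero_mem' := fun s _ => by simp
  add_mem' := by
    rintro x y hx hy s hs
    simp [map_add, hx s hs, hy s hs]
  smul_mem' := by
    rintro c x hx s hs
    have h : B (c • x) s = c • (B x s) := by rw [map_zsmul]; rfl
    exact h.trans (by simp [hx s hs])

/-- The quotient `T / (S ∩ T)` of one `ℤ`-submodule of `V` by another. -/
abbrev quotIn (T S : Submodule ℤ (Fin n → ℚ)) : Type :=
  T ⧸ (S.comap T.subtype)

/-- The discriminant group `discr S = S*/S`. -/
abbrev discrGrp (B : LinearMap.BilinForm ℚ (Fin n → ℚ)) (S : Submodule ℤ (Fin n → ℚ)) :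
    Type := quotIn (dualLat B S) S

/-- The class in `discr S` of an element of the dual lattice. -/
abbrev discrCls (B : LinearMap.BilinForm ℚ (Fin n → ℚ)) (S : Submodule ℤ (Fin n → ℚ))
    (x : ↥(dualLat B S)) : discrGrp B S :=
  (S.comap (dualLat B S).subtype).mkQ x

/-- The kernel `K = M/S ⊆ discr S` of a finite-index extension `M ⊃ S`. -/
abbrev extKer (B : LinearMap.BilinForm ℚ (Fin n → ℚ)) (S M : Submodule ℤ (Fin n → ℚ)) :
    Submodule ℤ (discrGrp B S) :=
  (M.comap (dualLat B S).subtype).map (S.comap (dualLat B S).subtype).mkQ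

/-- The minimal number of generators of an (additive) abelian group. -/
noncomputable def minGen (A : Type*) [AddCommGroup A] : ℕ :=
  sInf {m | ∃ f : Fin m → A, AddSubgroup.closure (Set.range f) = ⊤}

/-- `ℓ_p`: the minimal number of generators of the `p`-primary part. -/
noncomputable def ellp (p : ℕ) [Fact p.Prime] (A : Type*) [AddCommGroup A] : ℕ :=
  minGen (AddCommGroup.primaryComponent A p)

lemma exists_closure_range_eq_top_of_addEquiv {A B : Type*} [AddCommGroup A] [AddCommGroup B]
    (e : A ≃+ B) {m : ℕ} (h : ∃ f : Fin m → A, AddSubgroup.closure (Set.range f) = ⊤) :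
    ∃ f : Fin m → B, AddSubgroup.closure (Set.range f) = ⊤ := by
  obtain ⟨f, hf⟩ := h
  refine ⟨e ∘ f, ?_⟩
  have h := AddMonoidHom.map_closure e.toAddMonoidHom (Set.range f)
  rw [hf, AddSubgroup.map_top_of_surjective _ e.surjective] at h
  rw [Set.range_comp]
  exact h.symm

lemma minGen_congr {A B : Type*} [AddCommGroup A] [AddCommGroup B] (e : A ≃+ B) :
    minGen A = minGen B :=
  congrArg sInf <| Set.ext fun _ =>
    ⟨exists_closure_range_eq_top_of_addEquiv e, exists_closure_range_eq_top_of_addEquiv e.symm⟩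

/-- An additive relation that is bijective in both directions is the graph of an isomorphism. -/
lemma AddSubgroup.exists_addEquiv_of_bijective {A B : Type*} [AddCommGroup A] [AddCommGroup B]
    (G : AddSubgroup (A × B)) (hl : ∀ a, ∃ b, (a, b) ∈ G) (hr : ∀ b, ∃ a, (a, b) ∈ G)
    (hl0 : ∀ b, (0, b) ∈ G → b = 0) (hr0 : ∀ a, (a, 0) ∈ G → a = 0) :
    ∃ κ : A ≃+ B, ∀ a b, κ a = b ↔ (a, b) ∈ G := by
  have h1 : Function.Bijective ((AddMonoidHom.fst A B).comp G.subtype) := by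
    refine ⟨(injective_iff_map_eq_zero _).2 ?_, fun a => ?_⟩
    · rintro ⟨⟨a, b⟩, h⟩ (rfl : a = 0)
      simpa using hl0 b h
    · obtain ⟨b, hb⟩ := hl a
      exact ⟨⟨_, hb⟩, rfl⟩
  have h2 : Function.Bijective ((AddMonoidHom.snd A B).comp G.subtype) := by
    refine ⟨(injective_iff_map_eq_zero _).2 ?_, fun b => ?_⟩
    · rintro ⟨⟨a, b⟩, h⟩ (rfl : b = 0)
      simpa using hr0 a h
    · obtain ⟨a, ha⟩ := hr b
      exact ⟨⟨_, ha⟩, rfl⟩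
  refine ⟨(AddEquiv.ofBijective _ h1).symm.trans (AddEquiv.ofBijective _ h2), fun a b => ?_⟩
  obtain ⟨⟨⟨a', b'⟩, hg⟩, rfl⟩ := h1.2 a
  have : (AddEquiv.ofBijective _ h1).symm
      (((AddMonoidHom.fst A B).comp G.subtype) ⟨(a', b'), hg⟩) = ⟨(a', b'), hg⟩ :=
    (AddEquiv.ofBijective _ h1).symm_apply_apply ⟨(a', b'), hg⟩
  rw [AddEquiv.trans_apply, this]
  change b' = b ↔ (a', b) ∈ G
  constructor
  · rintro rfl
    exact hg
  · intro h
    have := G.sub_mem h hg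
    simp only [Prod.mk_sub_mk, sub_self] at this
    exact (sub_eq_zero.1 (hl0 _ this)).symm

lemma exists_zsmul_mem_of_mem_span {V : Type*} [AddCommGroup V] [Module ℚ V]
    (L : Submodule ℤ V) {x : V} (hx : x ∈ Submodule.span ℚ (L : Set V)) :
    ∃ m : ℤ, m ≠ 0 ∧ m • x ∈ L := by
  induction hx using Submodule.span_induction with
  | mem x h => exact ⟨1, one_ne_zero, by simpa using h⟩
  | zero => exact ⟨1, one_ne_zero, by simp⟩
  | add x y _ _ hx hy =>
    obtain ⟨m, hm, hmx⟩ := hx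
    obtain ⟨k, hk, hky⟩ := hy
    refine ⟨m * k, mul_ne_zero hm hk, ?_⟩
    rw [smul_add]
    refine L.add_mem ?_ ?_
    · rw [mul_comm, mul_smul]; exact L.smul_mem _ hmx
    · rw [mul_smul]; exact L.smul_mem _ hky
  | smul a x _ hx =>
    obtain ⟨m, hm, hmx⟩ := hx
    refine ⟨a.den * m, mul_ne_zero (by exact_mod_cast a.den_ne_zero) hm, ?_⟩
    have h : ((a.den * m : ℤ)) • a • x = a.num • m • x := by
      simp only [← Int.cast_smul_eq_zsmul ℚ, smul_smul]
      congr 1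
      push_cast
      rw [mul_right_comm, Rat.den_mul_eq_num]
    rw [h]
    exact L.smul_mem _ hmx

lemma zsmul_left_apply (B : LinearMap.BilinForm ℚ (Fin n → ℚ)) (m : ℤ) (x y : Fin n → ℚ) :
    B (m • x) y = m * B x y := by
  rw [← Int.cast_smul_eq_zsmul ℚ]; simp

lemma zsmul_right_apply (B : LinearMap.BilinForm ℚ (Fin n → ℚ)) (m : ℤ) (x y : Fin n → ℚ) :
    B x (m • y) = m * B x y := by
  rw [← Int.cast_smul_eq_zsmul ℚ]; simp

lemma IsIntegralLat.fg {B : LinearMap.BilinForm ℚ (Fin n → ℚ)} (hnd : B.Nondegenerate)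
    {M : Submodule ℤ (Fin n → ℚ)} (hlat : IsIntegralLat B M)
    (hspan : Submodule.span ℚ (M : Set (Fin n → ℚ)) = ⊤) : M.FG := by
  classical
  let b := Module.Basis.ofSpan hspan.ge
  have hb : Set.range b ⊆ M := Module.Basis.ofSpan_subset hspan.ge
  have hfin := Module.Finite.finite_basis b
  have hle : M ≤ Submodule.span ℤ (Set.range (B.dualBasis hnd b)) := by
    rw [← LinearMap.BilinForm.dualSubmodule_span_of_basis]
    intro x hx y hy
    obtain ⟨m, hm⟩ := hlat x hx y (Submodule.span_le.2 hb hy)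
    exact Submodule.mem_one.2 ⟨m, by simp [hm]⟩
  have : IsNoetherian ℤ (Submodule.span ℤ (Set.range (B.dualBasis hnd b))) :=
    isNoetherian_span_of_finite ℤ (Set.finite_range _)
  exact (isNoetherian_submodule.1 this) M hle

/-- A functional on a full lattice is represented by a vector. -/
lemma exists_apply_eq_of_linearMap {B : LinearMap.BilinForm ℚ (Fin n → ℚ)}
    (hnd : B.Nondegenerate) {M : Submodule ℤ (Fin n → ℚ)} (hfg : M.FG)
    (hspan : Submodule.span ℚ (M : Set (Fin n → ℚ)) = ⊤) (f : M →ₗ[ℤ] ℚ) :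
    ∃ w, ∀ x : M, B w x = f x := by
  have : Module.Finite ℤ M := Module.Finite.iff_fg.2 hfg
  let c := Module.Free.chooseBasis ℤ M
  have hli : LinearIndependent ℚ (fun i => (c i : Fin n → ℚ)) := by
    rw [← LinearIndependent.iff_fractionRing ℤ ℚ]
    exact c.linearIndependent.map' M.subtype M.ker_subtype
  have hsp : ⊤ ≤ Submodule.span ℚ (Set.range fun i => (c i : Fin n → ℚ)) := by
    rw [← hspan, Submodule.span_le]
    intro x hx
    have h := c.sum_repr ⟨x, hx⟩
    have h' : ∑ i, c.repr ⟨x, hx⟩ i • (c i : Fin n → ℚ) = x := by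
      simpa only [map_sum, map_smul, Submodule.subtype_apply] using congrArg M.subtype h
    rw [← h']
    refine Submodule.sum_mem _ fun i _ => ?_
    rw [← Int.cast_smul_eq_zsmul ℚ]
    exact Submodule.smul_mem _ _ (Submodule.subset_span ⟨i, rfl⟩)
  let b := Module.Basis.mk hli hsp
  let F : (Fin n → ℚ) →ₗ[ℚ] ℚ := b.constr ℚ fun i => f (c i)
  have hF : (F.restrictScalars ℤ).comp M.subtype = f := by
    refine c.ext fun i => ?_
    have : b i = (c i : Fin n → ℚ) := Module.Basis.mk_apply hli hsp i
    change F (c i) = f (c i)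
    rw [← this]
    exact b.constr_basis ℚ _ i
  refine ⟨(B.toDual hnd).symm F, fun x => ?_⟩
  rw [LinearMap.BilinForm.apply_toDual_symm_apply, ← hF]
  rfl

/-- An element of the dual of a primitive sublattice lifts to the dual of the whole lattice. -/
lemma exists_mem_dualLat_of_primitive {B : LinearMap.BilinForm ℚ (Fin n → ℚ)}
    (hnd : B.Nondegenerate) {S M : Submodule ℤ (Fin n → ℚ)} (hSM : S ≤ M) (hfg : M.FG)
    (hspan : Submodule.span ℚ (M : Set (Fin n → ℚ)) = ⊤)
    (hSprim : ∀ x ∈ M, ∀ m : ℤ, m ≠ 0 → m • x ∈ S → x ∈ S)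
    {y : Fin n → ℚ} (hy : y ∈ dualLat B S) :
    ∃ w ∈ dualLat B M, ∀ s ∈ S, B w s = B y s := by
  have : Module.Finite ℤ M := Module.Finite.iff_fg.2 hfg
  let S' : Submodule ℤ M := S.comap M.subtype
  have : Module.IsTorsionFree ℤ (M ⧸ S') := by
    rw [Module.isTorsionFree_iff_smul_eq_zero]
    intro m q hq
    obtain ⟨x, rfl⟩ := S'.mkQ_surjective q
    rw [← map_smul, Submodule.mkQ_apply, Submodule.Quotient.mk_eq_zero] at hq
    rw [or_iff_not_imp_left]
    intro hm
    rw [Submodule.mkQ_apply, Submodule.Quotient.mk_eq_zero]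
    exact hSprim x x.2 m hm hq
  obtain ⟨l, hl⟩ := S'.mkQ.exists_rightInverse_of_surjective S'.range_mkQ
  have hlS : ∀ x : M, (x : Fin n → ℚ) - l (S'.mkQ x) ∈ S := by
    intro x
    have : x - l (S'.mkQ x) ∈ S' := by
      rw [← Submodule.Quotient.mk_eq_zero, ← Submodule.mkQ_apply, map_sub, sub_eq_zero]
      exact (LinearMap.congr_fun hl _).symm
    exact this
  let f : M →ₗ[ℤ] ℚ := ((B y).restrictScalars ℤ).comp
    (M.subtype.comp (LinearMap.id - l.comp S'.mkQ))
  have hf : ∀ x : M, f x = B y ((x : Fin n → ℚ) - l (S'.mkQ x)) := fun x => rfl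
  obtain ⟨w, hw⟩ := exists_apply_eq_of_linearMap hnd hfg hspan f
  refine ⟨w, fun x hx => ?_, fun s hs => ?_⟩
  · rw [hw ⟨x, hx⟩, hf]
    exact hy _ (hlS _)
  · have h0 : S'.mkQ ⟨s, hSM hs⟩ = 0 := by
      rw [Submodule.mkQ_apply, Submodule.Quotient.mk_eq_zero]
      exact hs
    rw [hw ⟨s, hSM hs⟩, hf, h0]
    simp

/-- Gluing: over a `p`-unimodular lattice, every `p`-primary discriminant class of a primitive
sublattice is the component of a lattice vector. -/
lemma exists_add_mem_of_pUnimodular {p : ℕ} [Fact p.Prime]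
    {B : LinearMap.BilinForm ℚ (Fin n → ℚ)}
    (hnd : B.Nondegenerate) {S N M : Submodule ℤ (Fin n → ℚ)} (hSM : S ≤ M) (hNM : N ≤ M)
    (hN : ∀ x ∈ M, (∀ s ∈ S, B x s = 0) → x ∈ N) (hSN : ∀ s ∈ S, ∀ x ∈ N, B s x = 0)
    (hlat : IsIntegralLat B M)
    (hspan : Submodule.span ℚ (M : Set (Fin n → ℚ)) = ⊤)
    (hSprim : ∀ x ∈ M, ∀ m : ℤ, m ≠ 0 → m • x ∈ S → x ∈ S)
    (hpuni : ∀ x ∈ dualLat B M, (p : ℤ) • x ∈ M → x ∈ M)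
    {y : Fin n → ℚ} (hy : y ∈ dualLat B S) {k : ℕ} (hk : (p : ℤ) ^ k • y ∈ S) :
    ∃ z ∈ dualLat B N, (p : ℤ) ^ k • z ∈ N ∧ y + z ∈ M := by
  have hp : Prime (p : ℤ) := Nat.prime_iff_prime_int.1 Fact.out
  obtain ⟨w, hwM, hw⟩ :=
    exists_mem_dualLat_of_primitive hnd hSM (hlat.fg hnd hspan) hspan hSprim hy
  obtain ⟨D, hD, hDw⟩ := exists_zsmul_mem_of_mem_span M (x := w) (hspan ▸ Submodule.mem_top)
  have hmul : FiniteMultiplicity (p : ℤ) D :=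
    Int.finiteMultiplicity_iff.2 ⟨by simpa using (Fact.out : p.Prime).ne_one, hD⟩
  obtain ⟨m, hDm, hm⟩ := hmul.exists_eq_pow_mul_and_not_dvd
  have hpow : ∀ (i : ℕ) (v : Fin n → ℚ), v ∈ dualLat B M → (p : ℤ) ^ i • v ∈ M → v ∈ M := by
    intro i
    induction i with
    | zero => intro v _ h; simpa using h
    | succ i ih =>
      intro v hv h
      rw [pow_succ, mul_smul] at h
      exact hpuni v hv (ih _ (Submodule.smul_mem _ _ hv) h)
  have hmw : m • w ∈ M := by
    rw [hDm, mul_smul] at hDw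
    exact hpow _ _ (Submodule.smul_mem _ _ hwM) hDw
  obtain ⟨a, c, hac⟩ : IsCoprime m ((p : ℤ) ^ k) :=
    ((hp.coprime_iff_not_dvd.2 hm).pow_left).symm
  have hyN : ∀ x ∈ N, B y x = 0 := by
    intro x hx
    have h := hSN _ hk x hx
    rw [zsmul_left_apply] at h
    exact (mul_eq_zero.1 h).resolve_left (by exact_mod_cast pow_ne_zero k hp.ne_zero)
  have hxM : (a * m) • w ∈ M := by
    rw [mul_smul]
    exact M.smul_mem _ hmw
  refine ⟨(a * m) • w - (a * m) • y, fun x hx => ?_, hN _ ?_ fun s hs => ?_, ?_⟩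
  · rw [map_sub, LinearMap.sub_apply, zsmul_left_apply B _ y, hyN x hx, mul_zero, sub_zero]
    exact hlat _ hxM x (hNM hx)
  · rw [smul_sub, smul_comm ((p : ℤ) ^ k) (a * m) y]
    exact M.sub_mem (M.smul_mem _ hxM) (M.smul_mem _ (hSM hk))
  · rw [← smul_sub, zsmul_left_apply, zsmul_left_apply, map_sub, LinearMap.sub_apply, hw s hs]
    simp
  · have h : y + ((a * m) • w - (a * m) • y) = (a * m) • w + c • (p : ℤ) ^ k • y := by
      rw [smul_smul, eq_sub_of_add_eq' hac, sub_smul, one_smul]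
      abel
    rw [h]
    exact M.add_mem hxM (M.smul_mem _ (hSM hk))

lemma discrCls_eq_iff {B : LinearMap.BilinForm ℚ (Fin n → ℚ)} {S : Submodule ℤ (Fin n → ℚ)}
    {x y : dualLat B S} : discrCls B S x = discrCls B S y ↔ (x : Fin n → ℚ) - y ∈ S :=
  Submodule.Quotient.eq _

lemma discrCls_mem_primaryComponent_iff {p : ℕ} {B : LinearMap.BilinForm ℚ (Fin n → ℚ)}
    {S : Submodule ℤ (Fin n → ℚ)} {x : dualLat B S} :
    discrCls B S x ∈ AddCommGroup.primaryComponent (discrGrp B S) p ↔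
      ∃ k : ℕ, (p : ℤ) ^ k • (x : Fin n → ℚ) ∈ S := by
  rw [AddCommGroup.mem_primaryComponent]
  refine exists_congr fun k => ?_
  rw [← map_nsmul, Submodule.mkQ_apply, Submodule.Quotient.mk_eq_zero, ← natCast_zsmul]
  simp

/-- Pairs of `p`-primary discriminant classes glued together by a vector of `M`. -/
def gluePairs (p : ℕ) (B : LinearMap.BilinForm ℚ (Fin n → ℚ))
    (S N M : Submodule ℤ (Fin n → ℚ)) :
    AddSubgroup (AddCommGroup.primaryComponent (discrGrp B S) p ×
      AddCommGroup.primaryComponent (discrGrp B N) p) where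
  carrier := {q | ∃ (y : dualLat B S) (z : dualLat B N), discrCls B S y = q.1 ∧
    discrCls B N z = q.2 ∧ (y : Fin n → ℚ) + z ∈ M}
  zero_mem' := ⟨0, 0, by simp, by simp, by simp⟩
  add_mem' := by
    rintro q q' ⟨y, z, h1, h2, h3⟩ ⟨y', z', h1', h2', h3'⟩
    refine ⟨y + y', z + z', ?_, ?_, ?_⟩
    · simp [← h1, ← h1']
    · simp [← h2, ← h2']
    · rw [Submodule.coe_add, Submodule.coe_add, add_add_add_comm]
      exact M.add_mem h3 h3'
  neg_mem' := by
    rintro q ⟨y, z, h1, h2, h3⟩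
    refine ⟨-y, -z, by simp [← h1], by simp [← h2], ?_⟩
    rw [Submodule.coe_neg, Submodule.coe_neg, ← neg_add]
    exact M.neg_mem h3

/-- If two classes are glued, so are all their representatives. -/
lemma add_mem_of_mem_gluePairs {p : ℕ} {B : LinearMap.BilinForm ℚ (Fin n → ℚ)}
    {S N M : Submodule ℤ (Fin n → ℚ)} (hSM : S ≤ M) (hNM : N ≤ M)
    {q : AddCommGroup.primaryComponent (discrGrp B S) p ×
      AddCommGroup.primaryComponent (discrGrp B N) p} (hq : q ∈ gluePairs p B S N M)
    {y : dualLat B S} {z : dualLat B N} (hy : discrCls B S y = q.1) (hz : discrCls B N z = q.2) :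
    (y : Fin n → ℚ) + z ∈ M := by
  obtain ⟨y', z', h1, h2, h3⟩ := hq
  have hy' := hSM (discrCls_eq_iff.1 (hy.trans h1.symm))
  have hz' := hNM (discrCls_eq_iff.1 (hz.trans h2.symm))
  have h : (y : Fin n → ℚ) + z = (y' + z') + ((y - y') + (z - z')) := by abel
  rw [h]
  exact M.add_mem h3 (M.add_mem hy' hz')

lemma gluePairs_swap {p : ℕ} {B : LinearMap.BilinForm ℚ (Fin n → ℚ)}
    {S N M : Submodule ℤ (Fin n → ℚ)} {a b} :
    (a, b) ∈ gluePairs p B S N M ↔ (b, a) ∈ gluePairs p B N S M := by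
  constructor <;>
  · rintro ⟨y, z, h1, h2, h3⟩
    exact ⟨z, y, h2, h1, add_comm (y : Fin n → ℚ) z ▸ h3⟩

lemma exists_mem_gluePairs {p : ℕ} [Fact p.Prime] {B : LinearMap.BilinForm ℚ (Fin n → ℚ)}
    (hnd : B.Nondegenerate) {S N M : Submodule ℤ (Fin n → ℚ)} (hSM : S ≤ M) (hNM : N ≤ M)
    (hN : ∀ x ∈ M, (∀ s ∈ S, B x s = 0) → x ∈ N) (hSN : ∀ s ∈ S, ∀ x ∈ N, B s x = 0)
    (hlat : IsIntegralLat B M)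
    (hspan : Submodule.span ℚ (M : Set (Fin n → ℚ)) = ⊤)
    (hSprim : ∀ x ∈ M, ∀ m : ℤ, m ≠ 0 → m • x ∈ S → x ∈ S)
    (hpuni : ∀ x ∈ dualLat B M, (p : ℤ) • x ∈ M → x ∈ M)
    (a : AddCommGroup.primaryComponent (discrGrp B S) p) :
    ∃ b, (a, b) ∈ gluePairs p B S N M := by
  obtain ⟨a, ha⟩ := a
  obtain ⟨y, rfl⟩ := Submodule.mkQ_surjective _ a
  obtain ⟨k, hk⟩ := discrCls_mem_primaryComponent_iff.1 ha
  obtain ⟨z, hz, hkz, hyz⟩ :=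
    exists_add_mem_of_pUnimodular hnd hSM hNM hN hSN hlat hspan hSprim hpuni y.2 hk
  exact ⟨⟨discrCls B N ⟨z, hz⟩, discrCls_mem_primaryComponent_iff.2 ⟨k, hkz⟩⟩,
    y, ⟨z, hz⟩, rfl, rfl, hyz⟩

lemma eq_zero_of_zero_mem_gluePairs {p : ℕ} [Fact p.Prime]
    {B : LinearMap.BilinForm ℚ (Fin n → ℚ)} {S N M : Submodule ℤ (Fin n → ℚ)}
    (hSM : S ≤ M) (hNprim : ∀ x ∈ M, ∀ m : ℤ, m ≠ 0 → m • x ∈ N → x ∈ N)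
    {b : AddCommGroup.primaryComponent (discrGrp B N) p}
    (h : (0, b) ∈ gluePairs p B S N M) : b = 0 := by
  obtain ⟨b, hb⟩ := b
  obtain ⟨y, z, h1, rfl : discrCls B N z = b, h3⟩ := h
  obtain ⟨k, hk⟩ := discrCls_mem_primaryComponent_iff.1 hb
  have hyS : (y : Fin n → ℚ) ∈ S := by
    simpa using discrCls_eq_iff.1 (h1.trans (map_zero _).symm)
  have hzM : (z : Fin n → ℚ) ∈ M := by simpa using M.sub_mem h3 (hSM hyS)
  have hp : (p : ℤ) ≠ 0 := by exact_mod_cast (Fact.out : p.Prime).ne_zero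
  exact Subtype.ext ((Submodule.Quotient.mk_eq_zero _).2
    (hNprim _ hzM _ (pow_ne_zero k hp) hk))

/-- same setting as the unimodular case (`S`, `N = S^⊥` primitive in
`M`, `π` the orthogonal projection onto the span of `S`), but with `M` only
`p`-unimodular for a prime `p` (trivial `p`-primary part of `M*/M`).  Then the
anti-isometry given by the kernel restricts to an anti-isometry of the
`p`-primary parts `(discr S)_p → (discr N)_p`; in particular
`ℓ_p(discr S) = ℓ_p(discr N)`. -/
theorem stmt_12 (p : ℕ) [Fact p.Prime] {n : ℕ}
    (B : LinearMap.BilinForm ℚ (Fin n → ℚ)) (hsymm : B.IsSymm)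
    (hnd : B.Nondegenerate) (S N M : Submodule ℤ (Fin n → ℚ))
    (hSM : S ≤ M) (hNM : N ≤ M)
    (hN : ∀ x, x ∈ N ↔ x ∈ M ∧ ∀ s ∈ S, B x s = 0)
    (hlat : IsIntegralLat B M)
    (hfin : Finite (quotIn M (S ⊔ N)))
    (hSprim : ∀ x ∈ M, ∀ m : ℤ, m ≠ 0 → m • x ∈ S → x ∈ S)
    (hNprim : ∀ x ∈ M, ∀ m : ℤ, m ≠ 0 → m • x ∈ N → x ∈ N)
    (hspan : Submodule.span ℚ ((S ⊔ N : Submodule ℤ (Fin n → ℚ)) : Set (Fin n → ℚ)) = ⊤)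
    (π : (Fin n → ℚ) →ₗ[ℚ] (Fin n → ℚ))
    (hπS : ∀ x ∈ Submodule.span ℚ (S : Set (Fin n → ℚ)), π x = x)
    (hπN : ∀ x ∈ Submodule.span ℚ (N : Set (Fin n → ℚ)), π x = 0)
    (hπrange : ∀ x, π x ∈ Submodule.span ℚ (S : Set (Fin n → ℚ)))
    (hpuni : ∀ x ∈ dualLat B M, (p : ℤ) • x ∈ M → x ∈ M) :
    ∃ κ : ↥(AddCommGroup.primaryComponent (discrGrp B S) p) ≃+
        ↥(AddCommGroup.primaryComponent (discrGrp B N) p),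
      (∀ x ∈ M, ∀ (hx1 : π x ∈ dualLat B S) (hx2 : x - π x ∈ dualLat B N)
          (hp1 : discrCls B S ⟨π x, hx1⟩ ∈ AddCommGroup.primaryComponent (discrGrp B S) p),
        (κ ⟨discrCls B S ⟨π x, hx1⟩, hp1⟩ : discrGrp B N) = discrCls B N ⟨x - π x, hx2⟩) ∧
      (∀ (x x' : ↥(dualLat B S)) (y y' : ↥(dualLat B N))
          (hx : discrCls B S x ∈ AddCommGroup.primaryComponent (discrGrp B S) p)
          (hx' : discrCls B S x' ∈ AddCommGroup.primaryComponent (discrGrp B S) p),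
        (κ ⟨discrCls B S x, hx⟩ : discrGrp B N) = discrCls B N y →
        (κ ⟨discrCls B S x', hx'⟩ : discrGrp B N) = discrCls B N y' →
        IsIntQ (B (x : Fin n → ℚ) (x' : Fin n → ℚ) +
          B (y : Fin n → ℚ) (y' : Fin n → ℚ))) ∧
      ellp p (discrGrp B S) = ellp p (discrGrp B N) := by
  have hSN : ∀ s ∈ S, ∀ x ∈ N, B s x = 0 := fun s hs x hx =>
    (hsymm.eq s x).trans (((hN x).1 hx).2 s hs)
  have hNS : ∀ x ∈ N, ∀ s ∈ S, B x s = 0 := fun x hx s hs => ((hN x).1 hx).2 s hs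
  have hspanM : Submodule.span ℚ (M : Set (Fin n → ℚ)) = ⊤ :=
    top_le_iff.1 (hspan.ge.trans (Submodule.span_mono (sup_le hSM hNM)))
  have hdecomp : ∀ x : Fin n → ℚ, ∃ m : ℤ, m ≠ 0 ∧ ∃ s ∈ S, ∃ z ∈ N, s + z = m • x := by
    intro x
    obtain ⟨m, hm, hmx⟩ := exists_zsmul_mem_of_mem_span (S ⊔ N) (x := x)
      (hspan ▸ Submodule.mem_top)
    exact ⟨m, hm, Submodule.mem_sup.1 hmx⟩
  have hNtoS : ∀ x ∈ M, (∀ z ∈ N, B x z = 0) → x ∈ S := by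
    intro x hx hxN
    obtain ⟨m, hm, s, hs, z, hz, h⟩ := hdecomp x
    have hzN : ∀ z' ∈ N, B z z' = 0 := by
      intro z' hz'
      have h' := congrArg (fun v => B v z') h
      rwa [map_add, LinearMap.add_apply, zsmul_left_apply, hxN z' hz', hSN s hs z' hz', mul_zero,
        zero_add] at h'
    have hz0 : z = 0 := by
      refine hnd.1 z fun v => ?_
      obtain ⟨k, hk, s', hs', z', hz', hv⟩ := hdecomp v
      have h' := congrArg (B z) hv
      rw [zsmul_right_apply, map_add, hNS z hz s' hs', hzN z' hz', add_zero] at h'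
      exact (mul_eq_zero.1 h'.symm).resolve_left (by exact_mod_cast hk)
    refine hSprim x hx m hm ?_
    rw [← h, hz0, add_zero]
    exact hs
  obtain ⟨κ, hκ⟩ := (gluePairs p B S N M).exists_addEquiv_of_bijective
    (exists_mem_gluePairs hnd hSM hNM (fun x hx h => (hN x).2 ⟨hx, h⟩) hSN hlat hspanM hSprim
      hpuni)
    (fun b => (exists_mem_gluePairs hnd hNM hSM hNtoS hNS hlat hspanM hNprim hpuni b).imp
      fun _ => gluePairs_swap.1)
    (fun _ => eq_zero_of_zero_mem_gluePairs hSM hNprim)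
    (fun _ h => eq_zero_of_zero_mem_gluePairs hNM hSprim (gluePairs_swap.1 h))
  have hpQ : ∀ k : ℕ, (((p : ℤ) ^ k : ℤ) : ℚ) ≠ 0 := fun k => by
    exact_mod_cast pow_ne_zero k (Fact.out : p.Prime).ne_zero
  have horth : ∀ (x : dualLat B S) (y : dualLat B N),
      discrCls B S x ∈ AddCommGroup.primaryComponent (discrGrp B S) p →
      discrCls B N y ∈ AddCommGroup.primaryComponent (discrGrp B N) p →
      B (x : Fin n → ℚ) (y : Fin n → ℚ) = 0 := by
    intro x y hx hy
    obtain ⟨k, hk⟩ := discrCls_mem_primaryComponent_iff.1 hx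
    obtain ⟨j, hj⟩ := discrCls_mem_primaryComponent_iff.1 hy
    have h := hSN _ hk _ hj
    rw [zsmul_left_apply, zsmul_right_apply] at h
    exact (mul_eq_zero.1 ((mul_eq_zero.1 h).resolve_left (hpQ k))).resolve_left (hpQ j)
  refine ⟨κ, fun x hx hx1 hx2 hp1 => ?_, fun x x' y y' hx hx' hxy hxy' => ?_, minGen_congr κ⟩
  · obtain ⟨k, hk⟩ := discrCls_mem_primaryComponent_iff.1 hp1
    have hp2 : discrCls B N ⟨x - π x, hx2⟩ ∈
        AddCommGroup.primaryComponent (discrGrp B N) p := by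
      refine discrCls_mem_primaryComponent_iff.2 ⟨k, (hN _).2 ⟨?_, fun s hs => ?_⟩⟩
      · rw [smul_sub]
        exact M.sub_mem (M.smul_mem _ hx) (hSM hk)
      · obtain ⟨m, hm, s', hs', z, hz, h⟩ := hdecomp x
        have h' : m • (x - π x) = z := by
          rw [smul_sub, ← map_zsmul π, ← h, map_add, hπS _ (Submodule.subset_span hs'),
            hπN _ (Submodule.subset_span hz)]
          abel
        have h0 := hNS z hz s hs
        rw [← h', zsmul_left_apply] at h0
        rw [zsmul_left_apply, (mul_eq_zero.1 h0).resolve_left (by exact_mod_cast hm), mul_zero]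
    exact congrArg Subtype.val ((hκ ⟨discrCls B S ⟨π x, hx1⟩, hp1⟩
      ⟨discrCls B N ⟨x - π x, hx2⟩, hp2⟩).2
      ⟨⟨π x, hx1⟩, ⟨x - π x, hx2⟩, rfl, rfl, by simpa using hx⟩)
  · have hM := add_mem_of_mem_gluePairs hSM hNM ((hκ _ _).1 rfl) (y := x) (z := y)
      (q := (⟨_, hx⟩, _)) rfl hxy.symm
    have hM' := add_mem_of_mem_gluePairs hSM hNM ((hκ _ _).1 rfl) (y := x') (z := y')
      (q := (⟨_, hx'⟩, _)) rfl hxy'.symm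
    have hy := hxy ▸ (κ ⟨_, hx⟩).2
    have hy' := hxy' ▸ (κ ⟨_, hx'⟩).2
    have h1 := horth x y' hx hy'
    have h2 := (hsymm.eq _ _).symm.trans (horth x' y hx' hy)
    have h := hlat _ hM _ hM'
    simp only [map_add, LinearMap.add_apply] at h
    rw [h1, h2] at h
    simpa using h
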